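/- Let N be a positive integer, θ₀ ∈ [0,1], y an integer with 0 ≤ y ≤ N, and b a natural number with b ≤ y and y + b ≤ N. Then min over integers ỹ with |ỹ − y| ≤ b and 0 ≤ ỹ ≤ N of |ỹ/N − θ₀| equals max( |y/N − θ₀| − b/N , e_min ), where e_min = min over integers z with 0 ≤ z ≤ N of |z/N − θ₀| is the minimum achievable error. -/

import Mathlib

/-- Clamping an integer to an interval that contains `t` does not move it away from `t`. -/
lemma exists_int_mem_Icc_abs_sub_le {l u : ℤ} {t : ℝ} (hl : (l : ℝ) ≤ t) (hu : t ≤ u) (z : ℤ) :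
    ∃ w ∈ Set.Icc l u, |(w : ℝ) - t| ≤ |(z : ℝ) - t| := by
  have hlu : l ≤ u := by exact_mod_cast hl.trans hu
  rcases lt_or_ge z l with hzl | hzl
  · have hzl' : (z : ℝ) < l := by exact_mod_cast hzl
    refine ⟨l, ⟨le_rfl, hlu⟩, ?_⟩
    rw [abs_of_nonpos (by linarith), abs_of_nonpos (by linarith)]
    linarith
  rcases lt_or_ge u z with hzu | hzu
  · have hzu' : (u : ℝ) < z := by exact_mod_cast hzu
    refine ⟨u, ⟨hlu, le_rfl⟩, ?_⟩
    rw [abs_of_nonneg (by linarith), abs_of_nonneg (by linarith)]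
    linarith
  · exact ⟨z, ⟨hzl, hzu⟩, le_rfl⟩

/-- **Error formula for binomial data (Appendix B).**
Let `N` be a positive integer, `θ₀ ∈ [0,1]`, `y` an integer with `0 ≤ y ≤ N`, and `b`
a natural number with `b ≤ y` and `y + b ≤ N`.  Then the minimum over integers `ỹ`
with `|ỹ − y| ≤ b` and `0 ≤ ỹ ≤ N` of `|ỹ/N − θ₀|` equals
`max (|y/N − θ₀| − b/N) e_min`, where
`e_min = min over integers z with 0 ≤ z ≤ N of |z/N − θ₀|`. -/
theorem binomial_corrected_error_formula
    (N : ℕ) (hN : 0 < N) (θ₀ : ℝ) (hθ₀ : θ₀ ∈ Set.Icc (0 : ℝ) 1)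
    (y : ℤ) (hy0 : 0 ≤ y) (hyN : y ≤ N)
    (b : ℕ) (hby : (b : ℤ) ≤ y) (hyb : y + b ≤ N) :
    sInf {e : ℝ | ∃ ytilde : ℤ, |ytilde - y| ≤ (b : ℤ) ∧ 0 ≤ ytilde ∧ ytilde ≤ N ∧
        e = |(ytilde : ℝ) / N - θ₀|}
      = max (|(y : ℝ) / N - θ₀| - b / N)
          (sInf {e : ℝ | ∃ z : ℤ, 0 ≤ z ∧ z ≤ N ∧ e = |(z : ℝ) / N - θ₀|}) := by
  have hN' : (0 : ℝ) < N := by exact_mod_cast hN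
  have hscale (z : ℤ) : |(z : ℝ) / N - θ₀| = |(z : ℝ) - N * θ₀| / N := by
    rw [← abs_of_pos hN', ← abs_div, abs_of_pos hN']
    congr 1
    field_simp
  simp only [hscale, ← sub_div]
  set t : ℝ := N * θ₀
  have hbdd : BddBelow {e : ℝ | ∃ z : ℤ, 0 ≤ z ∧ z ≤ N ∧ e = |(z : ℝ) - t| / N} := by
    refine ⟨0, ?_⟩
    rintro _ ⟨z, -, -, rfl⟩
    positivity
  have hsub : {e : ℝ | ∃ w : ℤ, |w - y| ≤ (b : ℤ) ∧ 0 ≤ w ∧ w ≤ N ∧ e = |(w : ℝ) - t| / N} ⊆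
      {e : ℝ | ∃ z : ℤ, 0 ≤ z ∧ z ≤ N ∧ e = |(z : ℝ) - t| / N} := by
    rintro _ ⟨w, -, h0, h1, rfl⟩
    exact ⟨w, h0, h1, rfl⟩
  have hne : {e : ℝ | ∃ w : ℤ, |w - y| ≤ (b : ℤ) ∧ 0 ≤ w ∧ w ≤ N ∧
      e = |(w : ℝ) - t| / N}.Nonempty := ⟨_, y, by simp, hy0, hyN, rfl⟩
  have hle (w : ℤ) (hw : w ∈ Set.Icc (y - b) (y + b)) :
      sInf {e : ℝ | ∃ w : ℤ, |w - y| ≤ (b : ℤ) ∧ 0 ≤ w ∧ w ≤ N ∧ e = |(w : ℝ) - t| / N} ≤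
        |(w : ℝ) - t| / N := by
    obtain ⟨h1, h2⟩ := hw
    exact csInf_le (hbdd.mono hsub)
      ⟨w, abs_le.2 ⟨by linarith, by linarith⟩, by linarith, by linarith, rfl⟩
  have hb : (0 : ℤ) ≤ b := by positivity
  have hb' : (0 : ℝ) ≤ b := by positivity
  apply le_antisymm
  · rcases lt_or_ge t ((y - b : ℤ) : ℝ) with hl | hl
    · refine (hle (y - b) ⟨le_rfl, by linarith⟩).trans (le_max_of_le_left ?_)
      push_cast at hl ⊢
      rw [abs_of_pos (by linarith), abs_of_pos (by linarith)]
      gcongr ?_ / _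
      linarith
    rcases lt_or_ge ((y + b : ℤ) : ℝ) t with hu | hu
    · refine (hle (y + b) ⟨by linarith, le_rfl⟩).trans (le_max_of_le_left ?_)
      push_cast at hu ⊢
      rw [abs_of_neg (by linarith), abs_of_neg (by linarith)]
      gcongr ?_ / _
      linarith
    · refine le_max_of_le_right (le_csInf (hne.mono hsub) ?_)
      rintro _ ⟨z, -, -, rfl⟩
      obtain ⟨w, hw, hwz⟩ := exists_int_mem_Icc_abs_sub_le hl hu z
      exact (hle w hw).trans (by gcongr)
  · refine max_le (le_csInf hne ?_) (csInf_le_csInf hbdd hne hsub)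
    rintro _ ⟨w, hw, -, -, rfl⟩
    have hw' : |(w : ℝ) - y| ≤ b := by exact_mod_cast hw
    have htri := abs_sub_le (y : ℝ) w t
    rw [abs_sub_comm (y : ℝ) w] at htri
    gcongr ?_ / _
    linarith
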